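/- arXiv:2506.10279 — 3 statements merged into one kernel-verified Lean document; each statement's English description precedes it below -/
import Mathlib

section
/- Let ι be a type and k : ι → ι → ℝ a symmetric positive semidefinite kernel, i.e., k(z, z′) = k(z′, z) for all z, z′ and for every m ∈ ℕ and every family w : Fin m → ι the Gram matrix (k(w(i), w(j)))_{i,j} is positive semidefinite. Let σ_ns > 0, N ∈ ℕ, and z : Fin N → ι. For 0 ≤ q < N, let σ²_q(z(q)) denote the posterior variance at z(q) conditioned on the first q points z(0), …, z(q−1), i.e., σ²_q(z(q)) = k(z(q), z(q)) − k_q(z(q))ᵀ (K_q + σ_ns² I)⁻¹ k_q(z(q)) with K_q the q×q Gram matrix of z(0), …, z(q−1) and k_q(z(q)) the cross-kernel vector. Then det(I_N + σ_ns⁻² K_N) = ∏_{q=0}^{N−1} (1 + σ_ns⁻² σ²_q(z(q))), where K_N is the N×N Gram matrix of z(0), …, z(N−1). -/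
open Matrix

/-- A symmetric positive semidefinite kernel: symmetric, and every finite Gram matrix
is positive semidefinite. -/
def IsPSDKernel {ι : Type*} (k : ι → ι → ℝ) : Prop :=
  (∀ z z', k z z' = k z' z) ∧
    ∀ (m : ℕ) (w : Fin m → ι),
      (Matrix.of fun i j : Fin m => k (w i) (w j)).PosSemidef

/-- The Gaussian process posterior variance at a test point `zs`, conditioned on the
points `z 0, …, z (q-1)` with observation noise level `σns`:
`σ²_q(z*) = k(z*,z*) − k_q(z*)ᵀ (K_q + σns² I)⁻¹ k_q(z*)`. -/
noncomputable def postVar {ι : Type*} (k : ι → ι → ℝ) (σns : ℝ)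
    (q : ℕ) (z : Fin q → ι) (zs : ι) : ℝ :=
  k zs zs -
    dotProduct (fun i => k (z i) zs)
      (Matrix.mulVec
        ((Matrix.of (fun i j : Fin q => k (z i) (z j)) +
            σns ^ 2 • (1 : Matrix (Fin q) (Fin q) ℝ))⁻¹)
        (fun i => k (z i) zs))

/-- Schur complement step: adding one point multiplies `det (K + σ² I)` by `σ² + σ²_n`. -/
theorem det_gram_succ
    {ι : Type*} (k : ι → ι → ℝ) (hk : IsPSDKernel k)
    (σns : ℝ) (hσ : 0 < σns) (n : ℕ) (z : Fin (n + 1) → ι) :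
    (Matrix.of (fun i j : Fin (n + 1) => k (z i) (z j)) +
        σns ^ 2 • (1 : Matrix (Fin (n + 1)) (Fin (n + 1)) ℝ)).det =
      (Matrix.of (fun i j : Fin n => k (z i.castSucc) (z j.castSucc)) +
        σns ^ 2 • (1 : Matrix (Fin n) (Fin n) ℝ)).det *
      (σns ^ 2 + postVar k σns n (fun i => z i.castSucc) (z (Fin.last n))) := by
  have hpd : (Matrix.of (fun i j : Fin n => k (z i.castSucc) (z j.castSucc)) +
        σns ^ 2 • (1 : Matrix (Fin n) (Fin n) ℝ)).PosDef :=
    Matrix.PosDef.posSemidef_add (hk.2 n fun i => z i.castSucc)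
      (Matrix.PosDef.one.smul (by positivity))
  unfold postVar
  set A := Matrix.of (fun i j : Fin n => k (z i.castSucc) (z j.castSucc)) +
        σns ^ 2 • (1 : Matrix (Fin n) (Fin n) ℝ) with hA
  haveI : Invertible A := hpd.isUnit.invertible
  have hblk : (Matrix.of (fun i j : Fin (n + 1) => k (z i) (z j)) +
        σns ^ 2 • (1 : Matrix (Fin (n + 1)) (Fin (n + 1)) ℝ)).submatrix
          (finSumFinEquiv (m := n) (n := 1)) (finSumFinEquiv (m := n) (n := 1)) =
      Matrix.fromBlocks A
        (Matrix.of fun (i : Fin n) (_ : Fin 1) => k (z i.castSucc) (z (Fin.last n)))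
        (Matrix.of fun (_ : Fin 1) (i : Fin n) => k (z i.castSucc) (z (Fin.last n)))
        (Matrix.of fun (_ : Fin 1) (_ : Fin 1) =>
          k (z (Fin.last n)) (z (Fin.last n)) + σns ^ 2) := by
    have hl : ∀ a : Fin 1, Fin.natAdd n a = Fin.last n := by
      intro a; ext; simp
    have hc : ∀ a : Fin n, Fin.castAdd 1 a = a.castSucc := fun _ => rfl
    ext i j
    rcases i with i | i <;> rcases j with j | j
    · simp [hA, hc, Matrix.one_apply]
    · simp [hl, hc, Matrix.one_apply, (Fin.castSucc_lt_last i).ne]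
    · simp [hl, hc, Matrix.one_apply, (Fin.castSucc_lt_last j).ne', hk.1 (z (Fin.last n))]
    · simp [hl, Matrix.one_apply]
  rw [← Matrix.det_submatrix_equiv_self (finSumFinEquiv (m := n) (n := 1)), hblk,
    Matrix.det_fromBlocks₁₁, Matrix.invOf_eq_nonsing_inv, Matrix.det_fin_one]
  congr 1
  rw [Matrix.mul_assoc]
  simp only [Matrix.sub_apply, Matrix.mul_apply, Matrix.of_apply, dotProduct, Matrix.mulVec]
  ring

/-- Product formula for the unnormalised determinant. -/
theorem det_gram_eq_prod
    {ι : Type*} (k : ι → ι → ℝ) (hk : IsPSDKernel k)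
    (σns : ℝ) (hσ : 0 < σns) (N : ℕ) (z : Fin N → ι) :
    (Matrix.of (fun i j : Fin N => k (z i) (z j)) +
        σns ^ 2 • (1 : Matrix (Fin N) (Fin N) ℝ)).det =
      ∏ q : Fin N, (σns ^ 2 +
          postVar k σns q (fun i : Fin q => z (Fin.castLE q.isLt.le i)) (z q)) := by
  induction N with
  | zero => simp
  | succ n ih =>
    rw [det_gram_succ k hk σns hσ, ih (fun i => z i.castSucc), Fin.prod_univ_castSucc]
    rfl

/-- the telescoping determinant identity
`det (I_N + σns⁻² K_N) = ∏_{q=0}^{N-1} (1 + σns⁻² σ²_q(z q))`, where `σ²_q(z q)` is the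
posterior variance at `z q` conditioned on the first `q` points. -/
theorem det_eq_prod_posterior_variances
    {ι : Type*} (k : ι → ι → ℝ) (hk : IsPSDKernel k)
    (σns : ℝ) (hσ : 0 < σns) (N : ℕ) (z : Fin N → ι) :
    ((1 : Matrix (Fin N) (Fin N) ℝ) +
        (σns ^ 2)⁻¹ • Matrix.of (fun i j : Fin N => k (z i) (z j))).det =
      ∏ q : Fin N,
        (1 + (σns ^ 2)⁻¹ *
          postVar k σns q (fun i : Fin q => z (Fin.castLE q.isLt.le i)) (z q)) := by
  have hs : σns ^ 2 ≠ 0 := by positivity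
  have h : (1 : Matrix (Fin N) (Fin N) ℝ) +
        (σns ^ 2)⁻¹ • Matrix.of (fun i j : Fin N => k (z i) (z j)) =
      (σns ^ 2)⁻¹ • (Matrix.of (fun i j : Fin N => k (z i) (z j)) +
        σns ^ 2 • (1 : Matrix (Fin N) (Fin N) ℝ)) := by
    rw [smul_add, smul_smul, inv_mul_cancel₀ hs, one_smul, add_comm]
  rw [h, Matrix.det_smul, det_gram_eq_prod k hk σns hσ, ← Finset.card_univ,
    ← Finset.prod_const, ← Finset.prod_mul_distrib]
  refine Finset.prod_congr rfl fun q _ => ?_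
  rw [mul_add, inv_mul_cancel₀ hs]
end

section
/- Let ι be a type and k : ι → ι → ℝ a symmetric positive semidefinite kernel, i.e., k(z, z′) = k(z′, z) for all z, z′ and for every m ∈ ℕ and every family w : Fin m → ι the Gram matrix (k(w(i), w(j)))_{i,j} is positive semidefinite. Assume moreover k(z, z) ≤ 1 for all z ∈ ι. Let σ_ns > 0, N ∈ ℕ, and z : Fin N → ι, and for 0 ≤ q < N let σ²_q(z(q)) = k(z(q), z(q)) − k_q(z(q))ᵀ (K_q + σ_ns² I)⁻¹ k_q(z(q)) be the posterior variance at z(q) conditioned on the first q points. Then ∑_{q=0}^{N−1} σ²_q(z(q)) ≤ (2 / log(1 + σ_ns⁻²)) · (1/2) · log det(I_N + σ_ns⁻² K_N), where K_N is the N×N Gram matrix of z(0), …, z(N−1). -/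
open Matrix

lemma pv_scalar (s v : ℝ) (hs : 0 < s) (h0 : 0 ≤ v) (h1 : v ≤ 1) :
    v * Real.log (1 + s⁻¹) ≤ Real.log (1 + s⁻¹ * v) := by
  have hs' : 0 < s⁻¹ := inv_pos.mpr hs
  have h := rpow_one_add_le_one_add_mul_self (s := s⁻¹) (p := v) (by linarith) h0 h1
  rw [← Real.log_rpow (by linarith)]
  apply Real.log_le_log
  · positivity
  · linarith [mul_comm v s⁻¹]

lemma pv_posDef {ι : Type*} (k : ι → ι → ℝ) (hk : IsPSDKernel k) (s : ℝ) (hs : 0 < s)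
    (n : ℕ) (z : Fin n → ι) :
    (Matrix.of (fun i j : Fin n => k (z i) (z j)) + s • (1 : Matrix (Fin n) (Fin n) ℝ)).PosDef :=
  Matrix.PosDef.posSemidef_add (hk.2 n z) (Matrix.PosDef.one.smul hs)

/-- the cross-kernel column -/
def pvCol {ι : Type*} (k : ι → ι → ℝ) (n : ℕ) (z : Fin n → ι) (zs : ι) :
    Matrix (Fin n) (Fin 1) ℝ := Matrix.of fun i _ => k (z i) zs

lemma pv_schur {ι : Type*} (k : ι → ι → ℝ) (σ c : ℝ) (n : ℕ) (z : Fin n → ι) (zs : ι) :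
    (Matrix.of (fun _ _ : Fin 1 => k zs zs + c)) - (pvCol k n z zs)ᴴ *
      (Matrix.of (fun i j : Fin n => k (z i) (z j)) + σ ^ 2 • (1 : Matrix (Fin n) (Fin n) ℝ))⁻¹ *
      pvCol k n z zs = Matrix.of (fun _ _ : Fin 1 => postVar k σ n z zs + c) := by
  ext i j
  rw [Matrix.mul_assoc]
  simp only [Matrix.sub_apply, Matrix.of_apply, Matrix.mul_apply, postVar, dotProduct,
    Matrix.mulVec, pvCol, Matrix.conjTranspose_apply, star_trivial]
  ring

lemma pv_nonneg {ι : Type*} (k : ι → ι → ℝ) (hk : IsPSDKernel k) (σ : ℝ) (hσ : 0 < σ)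
    (n : ℕ) (z : Fin n → ι) (zs : ι) : 0 ≤ postVar k σ n z zs := by
  have hA := pv_posDef k hk (σ ^ 2) (by positivity) n z
  have : Invertible (Matrix.of (fun i j : Fin n => k (z i) (z j)) +
    σ ^ 2 • (1 : Matrix (Fin n) (Fin n) ℝ)) := hA.isUnit.invertible
  have key := (Matrix.PosDef.fromBlocks₁₁ (pvCol k n z zs)
    (Matrix.of (fun _ _ : Fin 1 => k zs zs + 0)) hA).mp ?_
  · rw [pv_schur] at key
    have := key.diag_nonneg (i := 0)
    simpa using this
  · have h1 := (hk.2 (n + 1) (Fin.append z (fun _ : Fin 1 => zs))).submatrix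
      (finSumFinEquiv (m := n) (n := 1))
    have h2 : (Matrix.diagonal (Sum.elim (fun _ : Fin n => σ ^ 2) (fun _ : Fin 1 => (0 : ℝ)))).PosSemidef := by
      apply Matrix.PosSemidef.diagonal
      rintro (i | i)
      · simp; positivity
      · simp
    refine (congrArg Matrix.PosSemidef ?_).mpr (h1.add h2)
    ext i j
    rcases i with i | i <;> rcases j with j | j
    · by_cases h : i = j <;> simp [h, Matrix.one_apply, Matrix.diagonal_apply]
    · simp [pvCol]
    · simp [pvCol, hk.1 zs]
    · simp [Matrix.diagonal_apply]

lemma pv_le {ι : Type*} (k : ι → ι → ℝ) (hk : IsPSDKernel k) (σ : ℝ) (hσ : 0 < σ)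
    (n : ℕ) (z : Fin n → ι) (zs : ι) : postVar k σ n z zs ≤ k zs zs := by
  have hA := (pv_posDef k hk (σ ^ 2) (by positivity) n z).inv.posSemidef
  have := hA.dotProduct_mulVec_nonneg (fun i => k (z i) zs)
  simp only [star_trivial] at this
  unfold postVar
  linarith

lemma pv_det {ι : Type*} (k : ι → ι → ℝ) (hk : IsPSDKernel k) (σ : ℝ) (hσ : 0 < σ)
    (n : ℕ) (z : Fin (n + 1) → ι) :
    (Matrix.of (fun i j : Fin (n + 1) => k (z i) (z j)) + σ ^ 2 • 1).det =
    (Matrix.of (fun i j : Fin n => k (z i.castSucc) (z j.castSucc)) + σ ^ 2 • 1).det *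
      (postVar k σ n (fun i => z i.castSucc) (z (Fin.last n)) + σ ^ 2) := by
  have hA := pv_posDef k hk (σ ^ 2) (by positivity) n (fun i => z i.castSucc)
  have : Invertible (Matrix.of (fun i j : Fin n => k (z i.castSucc) (z j.castSucc)) +
    σ ^ 2 • (1 : Matrix (Fin n) (Fin n) ℝ)) := hA.isUnit.invertible
  have key := Matrix.det_fromBlocks₁₁ (Matrix.of (fun i j : Fin n => k (z i.castSucc) (z j.castSucc)) +
    σ ^ 2 • (1 : Matrix (Fin n) (Fin n) ℝ)) (pvCol k n (fun i => z i.castSucc) (z (Fin.last n)))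
    (pvCol k n (fun i => z i.castSucc) (z (Fin.last n)))ᴴ
    (Matrix.of (fun _ _ : Fin 1 => k (z (Fin.last n)) (z (Fin.last n)) + σ ^ 2))
  rw [Matrix.invOf_eq_nonsing_inv, pv_schur, Matrix.det_unique (n := Fin 1), Matrix.of_apply] at key
  rw [← key, ← Matrix.det_submatrix_equiv_self (finSumFinEquiv (m := n) (n := 1))]
  congr 1
  have e1 : ∀ i : Fin n, Fin.castAdd 1 i = i.castSucc := fun i => rfl
  have e2 : ∀ i : Fin 1, Fin.natAdd n i = Fin.last n := fun i => by ext; simp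
  ext i j
  rcases i with i | i <;> rcases j with j | j
  · simp [e1, Matrix.one_apply]
  · simp [pvCol, e1, e2, Matrix.one_apply, (Fin.castSucc_lt_last i).ne]
  · simp [pvCol, e1, e2, Matrix.one_apply, (Fin.castSucc_lt_last j).ne', hk.1 (z (Fin.last n))]
  · simp [e2]

lemma pv_det' {ι : Type*} (k : ι → ι → ℝ) (σ : ℝ) (hσ : 0 < σ) (n : ℕ) (z : Fin n → ι) :
    ((1 : Matrix (Fin n) (Fin n) ℝ) + (σ ^ 2)⁻¹ • Matrix.of (fun i j : Fin n => k (z i) (z j))).det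
    = ((σ ^ 2)⁻¹) ^ n * (Matrix.of (fun i j : Fin n => k (z i) (z j)) + σ ^ 2 • 1).det := by
  have h : (1 : Matrix (Fin n) (Fin n) ℝ) + (σ ^ 2)⁻¹ • Matrix.of (fun i j : Fin n => k (z i) (z j))
    = (σ ^ 2)⁻¹ • (Matrix.of (fun i j : Fin n => k (z i) (z j)) + σ ^ 2 • 1) := by
    rw [smul_add, smul_smul, inv_mul_cancel₀ (by positivity), one_smul, add_comm]
  rw [h, Matrix.det_smul, Fintype.card_fin]

lemma pv_main {ι : Type*} (k : ι → ι → ℝ) (hk : IsPSDKernel k)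
    (hk1 : ∀ z, k z z ≤ 1) (σns : ℝ) (hσ : 0 < σns) (N : ℕ) (z : Fin N → ι) :
    (∑ q : Fin N,
        postVar k σns q (fun i : Fin q => z (Fin.castLE q.isLt.le i)) (z q)) *
        Real.log (1 + (σns ^ 2)⁻¹) ≤
      Real.log (((1 : Matrix (Fin N) (Fin N) ℝ) +
              (σns ^ 2)⁻¹ • Matrix.of (fun i j : Fin N => k (z i) (z j))).det) := by
  induction N with
  | zero => simp
  | succ n ih =>
    have ih' := ih (fun i => z i.castSucc)
    have hs : 0 < σns ^ 2 := by positivity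
    have h0 := pv_nonneg k hk σns hσ n (fun i => z i.castSucc) (z (Fin.last n))
    have h1 := (pv_le k hk σns hσ n (fun i => z i.castSucc) (z (Fin.last n))).trans (hk1 _)
    have hsc := pv_scalar (σns ^ 2) _ hs h0 h1
    have hd : 0 < (Matrix.of (fun i j : Fin n => k (z i.castSucc) (z j.castSucc)) +
      σns ^ 2 • (1 : Matrix (Fin n) (Fin n) ℝ)).det :=
      (pv_posDef k hk (σns ^ 2) hs n (fun i => z i.castSucc)).det_pos
    rw [Fin.sum_univ_castSucc, add_mul, pv_det' k σns hσ, pv_det k hk σns hσ]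
    rw [pv_det' k σns hσ] at ih'
    set v := postVar k σns n (fun i => z i.castSucc) (z (Fin.last n)) with hv
    have e : ∀ D : ℝ, ((σns ^ 2)⁻¹) ^ (n + 1) * (D * (v + σns ^ 2)) =
        (((σns ^ 2)⁻¹) ^ n * D) * (1 + (σns ^ 2)⁻¹ * v) := by
      intro D
      have : (σns ^ 2)⁻¹ * σns ^ 2 = 1 := inv_mul_cancel₀ hs.ne'
      rw [pow_succ]
      linear_combination (((σns ^ 2)⁻¹) ^ n * D) * this
    rw [e, Real.log_mul (by positivity) (by positivity)]
    exact add_le_add ih' hsc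

/-- if additionally `k(z,z) ≤ 1`, the cumulative posterior variance of
sequentially queried points is bounded by `(2 / log (1 + σns⁻²))` times the information
gain `(1/2) log det (I_N + σns⁻² K_N)`. -/
theorem sum_posterior_variances_le_information_gain
    {ι : Type*} (k : ι → ι → ℝ) (hk : IsPSDKernel k)
    (hk1 : ∀ z, k z z ≤ 1)
    (σns : ℝ) (hσ : 0 < σns) (N : ℕ) (z : Fin N → ι) :
    ∑ q : Fin N,
        postVar k σns q (fun i : Fin q => z (Fin.castLE q.isLt.le i)) (z q) ≤
      (2 / Real.log (1 + (σns ^ 2)⁻¹)) *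
        ((1 / 2) * Real.log
          (((1 : Matrix (Fin N) (Fin N) ℝ) +
              (σns ^ 2)⁻¹ • Matrix.of (fun i j : Fin N => k (z i) (z j))).det)) := by
  have h := pv_main k hk hk1 σns hσ N z
  have hL : 0 < Real.log (1 + (σns ^ 2)⁻¹) := by
    apply Real.log_pos
    have : 0 < (σns ^ 2)⁻¹ := by positivity
    linarith
  rw [← le_div_iff₀ hL] at h
  refine h.trans (le_of_eq ?_)
  field_simp
end

section
/- Let ι be a type, n ≥ 1, and for each i ∈ Fin n let kᵢ : ι → ι → ℝ be a symmetric positive semidefinite kernel with kᵢ(z, z) ≤ 1 for all z ∈ ι, and let σᵢ > 0. Let N ∈ ℕ and z : Fin N → ι, and for 0 ≤ q < N let σ²_{i,q}(z(q)) = kᵢ(z(q), z(q)) − k_{i,q}(z(q))ᵀ (K_{i,q} + σᵢ² I)⁻¹ k_{i,q}(z(q)) be the posterior variance of the i-th kernel at z(q) conditioned on the first q points. Then ∑_{q=0}^{N−1} ∑_{i=1}^{n} σ²_{i,q}(z(q)) ≤ ∑_{i=1}^{n} (2 / log(1 + σᵢ⁻²)) · (1/2) · log det(I_N + σᵢ⁻²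 K_{i,N}), where K_{i,N} is the N×N Gram matrix of z(0), …, z(N−1) under kᵢ. -/
open Matrix

section helpers

lemma gp_A_posDef {ι : Type*} (k : ι → ι → ℝ) (hk : IsPSDKernel k) (s : ℝ) (hs : 0 < s)
    (N : ℕ) (w : Fin N → ι) :
    (Matrix.of (fun i j : Fin N => k (w i) (w j)) +
      s ^ 2 • (1 : Matrix (Fin N) (Fin N) ℝ)).PosDef := by
  have h1 : (s ^ 2 • (1 : Matrix (Fin N) (Fin N) ℝ)).PosDef :=
    Matrix.PosDef.one.smul (by positivity)
  exact Matrix.PosDef.posSemidef_add (hk.2 N w) h1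

lemma gp_schur {ι : Type*} (k : ι → ι → ℝ) (s : ℝ)
    (N : ℕ) (w : Fin N → ι) (x : ι) (d : ℝ) :
    (Matrix.of (fun _ _ : Fin 1 => k x x + d)) -
      (Matrix.of (fun (i : Fin N) (_ : Fin 1) => k (w i) x))ᴴ *
        (Matrix.of (fun i j : Fin N => k (w i) (w j)) +
          s ^ 2 • (1 : Matrix (Fin N) (Fin N) ℝ))⁻¹ *
      (Matrix.of (fun (i : Fin N) (_ : Fin 1) => k (w i) x)) =
      Matrix.of (fun _ _ : Fin 1 => postVar k s N w x + d) := by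
  ext a b
  rw [Matrix.mul_assoc]
  simp only [postVar, Matrix.sub_apply, Matrix.of_apply, Matrix.mul_apply, dotProduct,
    Matrix.mulVec, Matrix.conjTranspose_apply, star_trivial]
  ring

lemma gp_nonneg {ι : Type*} (k : ι → ι → ℝ) (hk : IsPSDKernel k) (s : ℝ) (hs : 0 < s)
    (N : ℕ) (w : Fin N → ι) (x : ι) : 0 ≤ postVar k s N w x := by
  have hA := gp_A_posDef k hk s hs N w
  letI : Invertible (Matrix.of (fun i j : Fin N => k (w i) (w j)) +
      s ^ 2 • (1 : Matrix (Fin N) (Fin N) ℝ)) := hA.isUnit.invertible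
  have h := (Matrix.PosDef.fromBlocks₁₁
    (Matrix.of (fun (i : Fin N) (_ : Fin 1) => k (w i) x))
    (Matrix.of (fun _ _ : Fin 1 => k x x + 0)) hA).1 ?_
  · rw [gp_schur] at h
    have := h.diag_nonneg (i := 0)
    simpa using this
  · have h1 := (hk.2 (N+1) (Fin.snoc w x : Fin (N+1) → ι)).submatrix
      (finSumFinEquiv : Fin N ⊕ Fin 1 ≃ Fin (N+1))
    have h2 : (Matrix.diagonal (Sum.elim (fun _ : Fin N => s^2) (fun _ : Fin 1 => (0:ℝ)))).PosSemidef := by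
      refine Matrix.PosSemidef.diagonal ?_
      rintro (i | i) <;> simp; positivity
    convert! h1.add h2 using 1
    ext (i | i) (j | j)
    · by_cases hij : i = j <;>
      simp [hij, Matrix.diagonal_apply, Matrix.one_apply, Fin.snoc]
    · simp [Fin.snoc]
    · simp [Fin.snoc, hk.1 x]
    · obtain rfl := Subsingleton.elim i j
      simp [Fin.snoc]

lemma gp_le {ι : Type*} (k : ι → ι → ℝ) (hk : IsPSDKernel k) (s : ℝ) (hs : 0 < s)
    (N : ℕ) (w : Fin N → ι) (x : ι) : postVar k s N w x ≤ k x x := by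
  have h := (gp_A_posDef k hk s hs N w).inv.posSemidef.dotProduct_mulVec_nonneg
    (fun i => k (w i) x)
  simp only [star_trivial] at h
  unfold postVar
  linarith

lemma gp_det {ι : Type*} (k : ι → ι → ℝ) (hk : IsPSDKernel k) (s : ℝ) (hs : 0 < s)
    (N : ℕ) (w : Fin (N+1) → ι) :
    (Matrix.of (fun i j : Fin (N+1) => k (w i) (w j)) +
      s ^ 2 • (1 : Matrix (Fin (N+1)) (Fin (N+1)) ℝ)).det =
    (Matrix.of (fun i j : Fin N => k (w i.castSucc) (w j.castSucc)) +
      s ^ 2 • (1 : Matrix (Fin N) (Fin N) ℝ)).det *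
    (postVar k s N (fun j => w j.castSucc) (w (Fin.last N)) + s ^ 2) := by
  have hA := gp_A_posDef k hk s hs N (fun j => w j.castSucc)
  letI : Invertible (Matrix.of (fun i j : Fin N => k (w i.castSucc) (w j.castSucc)) +
      s ^ 2 • (1 : Matrix (Fin N) (Fin N) ℝ)) := hA.isUnit.invertible
  have h := Matrix.det_fromBlocks₁₁ (Matrix.of (fun i j : Fin N => k (w i.castSucc) (w j.castSucc)) +
      s ^ 2 • (1 : Matrix (Fin N) (Fin N) ℝ))
    (Matrix.of (fun (i : Fin N) (_ : Fin 1) => k (w i.castSucc) (w (Fin.last N))))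
    (Matrix.of (fun (i : Fin N) (_ : Fin 1) => k (w i.castSucc) (w (Fin.last N))))ᴴ
    (Matrix.of (fun _ _ : Fin 1 => k (w (Fin.last N)) (w (Fin.last N)) + s ^ 2))
  rw [Matrix.invOf_eq_nonsing_inv, gp_schur k s N (fun j => w j.castSucc) (w (Fin.last N))] at h
  rw [Matrix.det_fin_one, Matrix.of_apply] at h
  rw [← h, ← Matrix.det_submatrix_equiv_self (finSumFinEquiv : Fin N ⊕ Fin 1 ≃ Fin (N+1))]
  congr 1
  have hl : ∀ i : Fin 1, Fin.natAdd N i = Fin.last N := by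
    intro i; ext; simp
  have hc : ∀ i : Fin N, Fin.castAdd 1 i = i.castSucc := fun i => rfl
  ext (i | i) (j | j)
  · simp [hc, Matrix.one_apply]
  · simp [hl, hc, Matrix.one_apply, (Fin.castSucc_lt_last i).ne]
  · simp [hl, hc, Matrix.one_apply, (Fin.castSucc_lt_last j).ne', hk.1 (w (Fin.last N))]
  · simp [hl]

lemma gp_M {ι : Type*} (k : ι → ι → ℝ) (s : ℝ) (hs : 0 < s)
    (N : ℕ) (w : Fin N → ι) :
    ((1 : Matrix (Fin N) (Fin N) ℝ) +
      (s ^ 2)⁻¹ • Matrix.of (fun p q : Fin N => k (w p) (w q))).det =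
    ((s ^ 2)⁻¹) ^ N * (Matrix.of (fun i j : Fin N => k (w i) (w j)) +
      s ^ 2 • (1 : Matrix (Fin N) (Fin N) ℝ)).det := by
  have h := Matrix.det_smul (Matrix.of (fun i j : Fin N => k (w i) (w j)) +
      s ^ 2 • (1 : Matrix (Fin N) (Fin N) ℝ)) ((s ^ 2)⁻¹)
  rw [Fintype.card_fin] at h
  rw [← h, smul_add, smul_smul, inv_mul_cancel₀ (by positivity), one_smul, add_comm]

lemma gp_bern (v t : ℝ) (hv : 0 ≤ v) (hv1 : v ≤ 1) (ht : 0 < t) :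
    v * Real.log (1 + t) ≤ Real.log (1 + v * t) := by
  rw [← Real.log_rpow (by positivity)]
  exact Real.log_le_log (by positivity)
    (rpow_one_add_le_one_add_mul_self (by linarith) hv hv1)

lemma gp_single {ι : Type*} (k : ι → ι → ℝ) (hk : IsPSDKernel k) (hk1 : ∀ z, k z z ≤ 1)
    (s : ℝ) (hs : 0 < s) (N : ℕ) : ∀ (z : Fin N → ι),
    (∑ q : Fin N, postVar k s q (fun j : Fin q => z (Fin.castLE q.isLt.le j)) (z q)) *
      Real.log (1 + (s ^ 2)⁻¹) ≤
    Real.log ((1 : Matrix (Fin N) (Fin N) ℝ) +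
      (s ^ 2)⁻¹ • Matrix.of (fun p q : Fin N => k (z p) (z q))).det := by
  induction N with
  | zero => intro z; simp
  | succ N ih =>
    intro z
    have ih' := ih (fun j => z j.castSucc)
    have hpos := (gp_A_posDef k hk s hs N (fun j => z j.castSucc)).det_pos
    have h0 := gp_nonneg k hk s hs N (fun j => z j.castSucc) (z (Fin.last N))
    have h1 := (gp_le k hk s hs N (fun j => z j.castSucc) (z (Fin.last N))).trans (hk1 _)
    have hb := gp_bern _ ((s ^ 2)⁻¹) h0 h1 (by positivity)
    have hM := gp_M k s hs N (fun j => z j.castSucc)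
    have hMpos : 0 < ((1 : Matrix (Fin N) (Fin N) ℝ) +
      (s ^ 2)⁻¹ • Matrix.of (fun p q : Fin N => k (z p.castSucc) (z q.castSucc))).det := by
      rw [hM]; positivity
    have hstep : ((1 : Matrix (Fin (N+1)) (Fin (N+1)) ℝ) +
      (s ^ 2)⁻¹ • Matrix.of (fun p q : Fin (N+1) => k (z p) (z q))).det =
      ((1 : Matrix (Fin N) (Fin N) ℝ) +
      (s ^ 2)⁻¹ • Matrix.of (fun p q : Fin N => k (z p.castSucc) (z q.castSucc))).det *
      (1 + postVar k s N (fun j => z j.castSucc) (z (Fin.last N)) * (s ^ 2)⁻¹) := by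
      rw [gp_M k s hs (N+1) z, hM, gp_det k hk s hs N z]
      have hi : (s ^ 2)⁻¹ * s ^ 2 = 1 := inv_mul_cancel₀ (by positivity)
      rw [pow_succ]
      generalize (s ^ 2)⁻¹ = t at hi ⊢
      generalize (Matrix.of (fun i j : Fin N => k (z i.castSucc) (z j.castSucc)) +
        s ^ 2 • (1 : Matrix (Fin N) (Fin N) ℝ)).det = D
      linear_combination t ^ N * D * hi
    rw [hstep, Real.log_mul hMpos.ne' (by positivity), Fin.sum_univ_castSucc, add_mul]
    exact add_le_add ih' hb

end helpers

/-- for `n` coordinate-wise Gaussian process models with kernels `kc i`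
(each symmetric PSD with `kc i z z ≤ 1`) and noise levels `σ i > 0`, the cumulative trace
of the posterior covariances of sequentially queried points is bounded by the sum of the
per-coordinate information-gain bounds. -/
theorem sum_trace_posterior_variances_le
    {ι : Type*} (n : ℕ) (hn : 1 ≤ n)
    (kc : Fin n → ι → ι → ℝ)
    (hk : ∀ i, IsPSDKernel (kc i))
    (hk1 : ∀ i z, kc i z z ≤ 1)
    (σ : Fin n → ℝ) (hσ : ∀ i, 0 < σ i)
    (N : ℕ) (z : Fin N → ι) :
    ∑ q : Fin N, ∑ i : Fin n,
        postVar (kc i) (σ i) q (fun j : Fin q => z (Fin.castLE q.isLt.le j)) (z q) ≤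
      ∑ i : Fin n,
        (2 / Real.log (1 + (σ i ^ 2)⁻¹)) *
          ((1 / 2) * Real.log
            (((1 : Matrix (Fin N) (Fin N) ℝ) +
                (σ i ^ 2)⁻¹ • Matrix.of (fun p q' : Fin N => kc i (z p) (z q'))).det)) := by
  rw [Finset.sum_comm]
  refine Finset.sum_le_sum fun i _ => ?_
  have h := gp_single (kc i) (hk i) (hk1 i) (σ i) (hσ i) N z
  have hs := hσ i
  have hl : 0 < Real.log (1 + (σ i ^ 2)⁻¹) :=
    Real.log_pos (by have : 0 < (σ i ^ 2)⁻¹ := by positivity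
                     linarith)
  rw [← le_div_iff₀ hl] at h
  refine h.trans (le_of_eq ?_)
  ring
end
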